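/- For every λ̄ ≥ 8π and Ē ≥ 1 there exists a constant C̄ = C̄(λ̄, Ē) > 0, depending only on λ̄ and Ē (in particular neither on the solution nor on the domain), such that for every simple domain Ω ⊂ ℝ², every λ ∈ (0, λ̄], and every solution u of P(λ,Ω) with energy ℰ(u) ≤ Ē, one has 0 ≤ u(x) ≤ C̄ for all x ∈ Ω. -/

import Mathlib

open MeasureTheory Real Set Filter

noncomputable section

/-- The Euclidean plane ℝ². -/
abbrev R2 : Type := EuclideanSpace ℝ (Fin 2)

/-- The Laplacian of `u : R2 → ℝ`: the sum of the second derivatives of `u`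
along the two coordinate axes. -/
def lap (u : R2 → ℝ) (p : R2) : ℝ :=
  ∑ i : Fin 2, iteratedDeriv 2 (fun t : ℝ => u (p + t • EuclideanSpace.single i (1 : ℝ))) 0

/-- `u` is a solution of the mean field problem `P(λ, Ω)`:
`u ∈ C²(Ω) ∩ C⁰(cl Ω)`, `u = 0` on `∂Ω` and `-Δu = λ eᵘ / ∫_Ω eᵘ` in `Ω`. -/
def IsSolP (Ω : Set R2) (lam : ℝ) (u : R2 → ℝ) : Prop :=
  ContDiffOn ℝ 2 u Ω ∧ ContinuousOn u (closure Ω) ∧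
    (∀ p ∈ frontier Ω, u p = 0) ∧
    ∀ p ∈ Ω, -lap u p = lam * Real.exp (u p) / ∫ q in Ω, Real.exp (u q)

/-- A simple domain: a bounded open simply connected set whose boundary is the support of a
simple rectifiable (i.e. of bounded variation) Jordan curve. -/
def IsSimpleDomain (Ω : Set R2) : Prop :=
  IsOpen Ω ∧ Bornology.IsBounded Ω ∧ SimplyConnectedSpace Ω ∧
    ∃ γ : ℝ → R2, ContinuousOn γ (Icc 0 1) ∧ γ 0 = γ 1 ∧ InjOn γ (Ico 0 1) ∧
      γ '' Icc 0 1 = frontier Ω ∧ BoundedVariationOn γ (Icc 0 1)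

/-- The energy `ℰ(u) = (1/(2λ)) ∫_Ω δ(u) u` where `δ(u) = eᵘ / ∫_Ω eᵘ`. -/
def energyE (Ω : Set R2) (lam : ℝ) (u : R2 → ℝ) : ℝ :=
  (1 / (2 * lam)) * ∫ p in Ω, (Real.exp (u p) / ∫ q in Ω, Real.exp (u q)) * u p

/-- The second derivative along a line through `p`, in terms of Fréchet derivatives. -/
lemma iteratedDeriv_two_line {v : R2 → ℝ} {p : R2} (hv : ContDiffAt ℝ 2 v p) (e : R2) :
    iteratedDeriv 2 (fun t : ℝ => v (p + t • e)) 0 =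
      fderiv ℝ (fun x => fderiv ℝ v x e) p e := by
  have hline : ∀ t : ℝ, HasDerivAt (fun t : ℝ => p + t • e) e t := fun t => by
    simpa using ((hasDerivAt_id t).smul_const e).const_add p
  have hcont : Tendsto (fun t : ℝ => p + t • e) (nhds 0) (nhds p) := by
    have := (hline 0).continuousAt.tendsto
    simpa using this
  have hev : ∀ᶠ x in nhds p, DifferentiableAt ℝ v x :=
    (hv.eventually (by simp)).mono fun x hx => hx.differentiableAt (by norm_num)
  have h1 : deriv (fun t : ℝ => v (p + t • e)) =ᶠ[nhds 0]
      fun t => fderiv ℝ v (p + t • e) e := by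
    filter_upwards [hcont.eventually hev] with t ht
    exact (ht.hasFDerivAt.comp_hasDerivAt t (hline t)).deriv
  have h2 : DifferentiableAt ℝ (fun x => fderiv ℝ v x e) p :=
    ((hv.fderiv_right (m := 1) (by norm_num)).differentiableAt (by norm_num)).clm_apply
      (differentiableAt_const e)
  rw [iteratedDeriv_succ, iteratedDeriv_one, h1.deriv_eq]
  have h3 : HasFDerivAt (fun x => fderiv ℝ v x e) (fderiv ℝ (fun x => fderiv ℝ v x e) p)
      (p + (0 : ℝ) • e) := by simpa using h2.hasFDerivAt
  exact (h3.comp_hasDerivAt (0 : ℝ) (hline 0)).deriv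

lemma lap_eq_sum_fderiv {v : R2 → ℝ} {p : R2} (hv : ContDiffAt ℝ 2 v p) :
    lap v p = ∑ i : Fin 2, fderiv ℝ (fun x => fderiv ℝ v x (EuclideanSpace.single i (1 : ℝ))) p
      (EuclideanSpace.single i (1 : ℝ)) :=
  Finset.sum_congr rfl fun _ _ => iteratedDeriv_two_line hv _

lemma contDiff_fderiv_apply {v : R2 → ℝ} (hv : ContDiff ℝ 2 v) (e : R2) :
    ContDiff ℝ 1 (fun x => fderiv ℝ v x e) :=
  (hv.fderiv_right (m := 1) (by norm_num)).clm_apply contDiff_const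

lemma continuous_fderiv_fderiv_apply {v : R2 → ℝ} (hv : ContDiff ℝ 2 v) (e : R2) :
    Continuous (fun x => fderiv ℝ (fun y => fderiv ℝ v y e) x e) :=
  ((contDiff_fderiv_apply hv e).continuous_fderiv (by norm_num)).clm_apply continuous_const

lemma continuous_lap {v : R2 → ℝ} (hv : ContDiff ℝ 2 v) : Continuous (lap v) := by
  have : lap v = fun p => ∑ i : Fin 2,
      fderiv ℝ (fun x => fderiv ℝ v x (EuclideanSpace.single i (1 : ℝ))) p
      (EuclideanSpace.single i (1 : ℝ)) := funext fun p => lap_eq_sum_fderiv hv.contDiffAt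
  rw [this]
  exact continuous_finsetSum _ fun i _ => continuous_fderiv_fderiv_apply hv _

lemma lap_congr {v w : R2 → ℝ} {p : R2} (h : v =ᶠ[nhds p] w) : lap v p = lap w p := by
  refine Finset.sum_congr rfl fun i _ => Filter.EventuallyEq.iteratedDeriv_eq 2 ?_
  have hc : Tendsto (fun t : ℝ => p + t • EuclideanSpace.single i (1 : ℝ)) (nhds 0) (nhds p) := by
    have : Continuous (fun t : ℝ => p + t • EuclideanSpace.single i (1 : ℝ)) := by fun_prop
    simpa using this.tendsto 0
  exact hc.eventually h

lemma hasCompactSupport_lap {v : R2 → ℝ} (hc : HasCompactSupport v) :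
    HasCompactSupport (lap v) := by
  refine HasCompactSupport.of_support_subset_isCompact hc fun p hp => ?_
  by_contra h
  refine hp ?_
  rw [lap_congr (notMem_tsupport_iff_eventuallyEq.1 h)]
  simp [lap]

/-- Green's second identity when one of the functions has compact support. -/
lemma integral_mul_lap {w ψ : R2 → ℝ} (hw : ContDiff ℝ 2 w) (hc : HasCompactSupport w)
    (hψ : ContDiff ℝ 2 ψ) : ∫ x, w x * lap ψ x = ∫ x, lap w x * ψ x := by
  have hw1 := hw.continuous
  have hψ1 := hψ.continuous
  have key : ∀ e : R2, ∫ x, w x * fderiv ℝ (fun y => fderiv ℝ ψ y e) x e =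
      ∫ x, fderiv ℝ (fun y => fderiv ℝ w y e) x e * ψ x := by
    intro e
    have a1 := (contDiff_fderiv_apply hw e).continuous
    have a2 := (contDiff_fderiv_apply hψ e).continuous
    have b1 := continuous_fderiv_fderiv_apply hw e
    have b2 := continuous_fderiv_fderiv_apply hψ e
    have c1 : HasCompactSupport (fun x => fderiv ℝ w x e) := hc.fderiv_apply ℝ e
    have c2 : HasCompactSupport (fun x => fderiv ℝ (fun y => fderiv ℝ w y e) x e) :=
      c1.fderiv_apply ℝ e
    have d1 := (contDiff_fderiv_apply hw e).differentiable (by norm_num)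
    have d2 := (contDiff_fderiv_apply hψ e).differentiable (by norm_num)
    rw [integral_mul_fderiv_eq_neg_fderiv_mul_of_integrable
      ((a1.mul a2).integrable_of_hasCompactSupport c1.mul_right)
      ((hw1.mul b2).integrable_of_hasCompactSupport hc.mul_right)
      ((hw1.mul a2).integrable_of_hasCompactSupport hc.mul_right)
      (fun x _ => (hw.differentiable (by norm_num)) x) (fun x _ => d2 x),
      integral_mul_fderiv_eq_neg_fderiv_mul_of_integrable
      ((b1.mul hψ1).integrable_of_hasCompactSupport c2.mul_right)
      ((a1.mul a2).integrable_of_hasCompactSupport c1.mul_right)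
      ((a1.mul hψ1).integrable_of_hasCompactSupport c1.mul_right)
      (fun x _ => d1 x) (fun x _ => (hψ.differentiable (by norm_num)) x), neg_neg]
  simp_rw [lap_eq_sum_fderiv hw.contDiffAt, lap_eq_sum_fderiv hψ.contDiffAt, Finset.mul_sum,
    Finset.sum_mul]
  rw [integral_finsetSum, integral_finsetSum]
  · exact Finset.sum_congr rfl fun i _ => key _
  · intro i _
    exact ((continuous_fderiv_fderiv_apply hw _).mul hψ1).integrable_of_hasCompactSupport
      ((hc.fderiv_apply ℝ _).fderiv_apply ℝ _).mul_right
  · intro i _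
    exact (hw1.mul (continuous_fderiv_fderiv_apply hψ _)).integrable_of_hasCompactSupport
      hc.mul_right

/-- For convex `φ`, the Laplacian of `φ ∘ u` is at least the derivative of `φ` at `u`
times the Laplacian of `u`. -/
lemma deriv_mul_lap_le_lap_comp {φ : ℝ → ℝ} (hφ : ContDiff ℝ 2 φ)
    (hconv : ∀ s, 0 ≤ deriv (deriv φ) s) {u : R2 → ℝ} {p : R2} (hu : ContDiffAt ℝ 2 u p) :
    deriv φ (u p) * lap u p ≤ lap (fun x => φ (u x)) p := by
  unfold lap
  rw [Finset.mul_sum]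
  refine Finset.sum_le_sum fun i _ => ?_
  set g : ℝ → ℝ := fun t => u (p + t • EuclideanSpace.single i (1 : ℝ)) with hg
  have hg0 : g 0 = u p := by simp [g]
  have hgc : ContDiffAt ℝ 2 g 0 := by
    have hu' : ContDiffAt ℝ 2 u (p + (0 : ℝ) • EuclideanSpace.single i (1 : ℝ)) := by simpa using hu
    exact hu'.comp (0 : ℝ) (f := fun t : ℝ => p + t • EuclideanSpace.single i (1 : ℝ))
      (by fun_prop)
  have hφ1 : ContDiff ℝ 1 (deriv φ) := by
    have : ContDiff ℝ (1 + 1) φ := by simpa [one_add_one_eq_two] using hφ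
    exact (contDiff_succ_iff_deriv.1 this).2.2
  have hev : ∀ᶠ t in nhds (0 : ℝ), DifferentiableAt ℝ g t :=
    (hgc.eventually (by simp)).mono fun x hx => hx.differentiableAt (by norm_num)
  have h1 : deriv (fun t => φ (g t)) =ᶠ[nhds 0] fun t => deriv φ (g t) * deriv g t := by
    filter_upwards [hev] with t ht
    exact ((hφ.differentiable (by norm_num) (g t)).hasDerivAt.comp t ht.hasDerivAt).deriv
  have hg1 : DifferentiableAt ℝ (deriv g) 0 := by
    have h := (hgc.fderiv_right (m := 1) (by norm_num)).differentiableAt (by norm_num)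
    exact h.clm_apply (differentiableAt_const (1 : ℝ))
  have h2 : HasDerivAt (fun t => deriv φ (g t) * deriv g t)
      (deriv (deriv φ) (g 0) * deriv g 0 * deriv g 0 + deriv φ (g 0) * deriv (deriv g) 0) 0 :=
    HasDerivAt.mul (((hφ1.differentiable (by norm_num) (g 0)).hasDerivAt).comp (0 : ℝ)
      hev.self_of_nhds.hasDerivAt) hg1.hasDerivAt
  change deriv φ (u p) * iteratedDeriv 2 g 0 ≤ iteratedDeriv 2 (fun t => φ (g t)) 0
  rw [iteratedDeriv_succ, iteratedDeriv_one, iteratedDeriv_succ, iteratedDeriv_one, h1.deriv_eq,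
    h2.deriv, hg0]
  have := mul_nonneg (hconv (u p)) (mul_self_nonneg (deriv g 0))
  nlinarith

/-- At an interior local minimum the Laplacian is nonnegative. -/
lemma lap_nonneg_of_isLocalMin {u : R2 → ℝ} {p : R2} (hu : ContinuousAt u p)
    (h : IsLocalMin u p) : 0 ≤ lap u p := by
  refine Finset.sum_nonneg fun i _ => ?_
  by_contra! hneg
  set g : ℝ → ℝ := fun t => u (p + t • EuclideanSpace.single i (1 : ℝ)) with hg
  have hc : Tendsto (fun t : ℝ => p + t • EuclideanSpace.single i (1 : ℝ)) (nhds 0) (nhds p) := by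
    have : Continuous (fun t : ℝ => p + t • EuclideanSpace.single i (1 : ℝ)) := by fun_prop
    simpa using this.tendsto 0
  have hg0 : g 0 = u p := by simp [g]
  have hmin : IsLocalMin g 0 := by
    filter_upwards [hc.eventually h] with t ht
    rw [hg0]; exact ht
  have hgc : ContinuousAt g 0 := by
    have : Tendsto g (nhds 0) (nhds (u p)) := hu.tendsto.comp hc
    rwa [← hg0] at this
  rw [iteratedDeriv_succ, iteratedDeriv_one] at hneg
  have hmax := isLocalMax_of_deriv_deriv_neg hneg hmin.deriv_eq_zero hgc
  have hconst : g =ᶠ[nhds 0] fun _ => g 0 := by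
    filter_upwards [hmin, hmax] with t h1 h2
    exact le_antisymm h2 h1
  have : deriv (deriv g) 0 = 0 := by
    rw [hconst.deriv.deriv_eq]; simp
  linarith

/-- A smooth convex truncation, vanishing on `(-∞, 1]` and with slope at most one. -/
def truncation (s : ℝ) : ℝ := ∫ x in (0 : ℝ)..s, Real.smoothTransition (x - 1)

lemma hasDerivAt_truncation (s : ℝ) :
    HasDerivAt truncation (Real.smoothTransition (s - 1)) s := by
  have hc : Continuous fun x : ℝ => Real.smoothTransition (x - 1) :=
    Real.smoothTransition.continuous.comp (by fun_prop)
  exact hc.integral_hasStrictDerivAt 0 s |>.hasDerivAt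

lemma deriv_truncation : deriv truncation = fun s => Real.smoothTransition (s - 1) :=
  funext fun s => (hasDerivAt_truncation s).deriv

lemma contDiff_truncation : ContDiff ℝ 2 truncation := by
  have : ContDiff ℝ (1 + 1) truncation := by
    refine contDiff_succ_iff_deriv.2
      ⟨fun s => (hasDerivAt_truncation s).differentiableAt, by simp, ?_⟩
    rw [deriv_truncation]
    exact (Real.smoothTransition.contDiff (n := 1)).comp (by fun_prop)
  simpa [one_add_one_eq_two] using this

lemma deriv_deriv_truncation_nonneg (s : ℝ) : 0 ≤ deriv (deriv truncation) s := by
  rw [deriv_truncation]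
  have : Monotone fun s : ℝ => Real.smoothTransition (s - 1) :=
    fun a b hab => Real.smoothTransition.monotone (by linarith)
  exact this.deriv_nonneg

lemma truncation_mono : Monotone truncation :=
  monotone_of_deriv_nonneg (fun s => (hasDerivAt_truncation s).differentiableAt)
    fun s => by rw [deriv_truncation]; exact Real.smoothTransition.nonneg _

lemma truncation_of_le_one {s : ℝ} (hs : s ≤ 1) : truncation s = 0 := by
  unfold truncation
  rw [intervalIntegral.integral_congr (g := fun _ => (0 : ℝ))]
  · simp
  · intro x hx
    refine Real.smoothTransition.zero_of_nonpos ?_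
    have : x ≤ max 0 s := hx.2
    have : max 0 s ≤ 1 := max_le zero_le_one hs
    linarith

lemma truncation_nonneg (s : ℝ) : 0 ≤ truncation s := by
  rcases le_total s 1 with h | h
  · rw [truncation_of_le_one h]
  · rw [← truncation_of_le_one (le_refl 1)]; exact truncation_mono h

lemma truncation_le_self {s : ℝ} (hs : 0 ≤ s) : truncation s ≤ s := by
  have hd : ∀ s, HasDerivAt (fun s => s - truncation s) (1 - Real.smoothTransition (s - 1)) s :=
    fun s => (hasDerivAt_id s).sub (hasDerivAt_truncation s)
  have hm : Monotone fun s => s - truncation s :=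
    monotone_of_deriv_nonneg (fun s => (hd s).differentiableAt)
      fun s => by rw [(hd s).deriv]; linarith [Real.smoothTransition.le_one (s - 1)]
  have := hm hs
  simp only [truncation_of_le_one zero_le_one] at this
  linarith

lemma sub_two_le_truncation (s : ℝ) : s - 2 ≤ truncation s := by
  rcases le_total s 2 with h | h
  · linarith [truncation_nonneg s]
  · have h2 : truncation s = truncation 2 + ∫ x in (2 : ℝ)..s, Real.smoothTransition (x - 1) := by
      have hc : Continuous fun x : ℝ => Real.smoothTransition (x - 1) :=
        Real.smoothTransition.continuous.comp (by fun_prop)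
      exact (intervalIntegral.integral_add_adjacent_intervals (hc.intervalIntegrable _ _)
        (hc.intervalIntegrable _ _)).symm
    rw [h2, intervalIntegral.integral_congr (g := fun _ => (1 : ℝ))]
    · simp [truncation_nonneg]
    · intro x hx
      rw [uIcc_of_le h] at hx
      exact Real.smoothTransition.one_of_one_le (by linarith [hx.1])

lemma contDiff_log_normSq_add {s : ℝ} (hs : 0 < s) (x₀ : R2) :
    ContDiff ℝ 2 fun x : R2 => Real.log (‖x - x₀‖ ^ 2 + s ^ 2) := by
  refine ContDiff.log ?_ fun x => by positivity
  exact ((contDiff_id.sub contDiff_const).norm_sq ℝ).add contDiff_const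

/-- The regularized logarithmic potential has a peaked Laplacian. -/
lemma lap_log_normSq_add {s : ℝ} (hs : 0 < s) (x₀ x : R2) :
    lap (fun x : R2 => Real.log (‖x - x₀‖ ^ 2 + s ^ 2)) x =
      4 * s ^ 2 / (‖x - x₀‖ ^ 2 + s ^ 2) ^ 2 := by
  set D : ℝ := ‖x - x₀‖ ^ 2 + s ^ 2 with hD
  have hDpos : 0 < D := by positivity
  have hline : ∀ i : Fin 2, iteratedDeriv 2 (fun t : ℝ => Real.log
      (‖x + t • EuclideanSpace.single i (1 : ℝ) - x₀‖ ^ 2 + s ^ 2)) 0 =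
      2 / D - 4 * (x - x₀) i ^ 2 / D ^ 2 := by
    intro i
    set z := (x - x₀) i with hz
    have hq : ∀ t : ℝ, ‖x + t • EuclideanSpace.single i (1 : ℝ) - x₀‖ ^ 2 + s ^ 2 =
        D + 2 * z * t + t ^ 2 := by
      intro t
      have : x + t • EuclideanSpace.single i (1 : ℝ) - x₀ =
          (x - x₀) + t • EuclideanSpace.single i (1 : ℝ) := by abel
      rw [this, norm_add_sq_real, inner_smul_right, norm_smul, EuclideanSpace.inner_single_right]
      simp [hD, hz]
      ring
    have hqpos : ∀ t : ℝ, 0 < D + 2 * z * t + t ^ 2 := fun t => by rw [← hq]; positivity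
    have hqd : ∀ t : ℝ, HasDerivAt (fun t : ℝ => D + 2 * z * t + t ^ 2) (2 * z + 2 * t) t := by
      intro t
      have := (((hasDerivAt_id t).const_mul (2 * z)).const_add D).fun_add (hasDerivAt_pow 2 t)
      simpa using this
    have h1 : deriv (fun t : ℝ => Real.log (D + 2 * z * t + t ^ 2)) =
        fun t => (2 * z + 2 * t) / (D + 2 * z * t + t ^ 2) :=
      funext fun t => ((hqd t).log (hqpos t).ne').deriv
    have h2 : HasDerivAt (fun t : ℝ => 2 * z + 2 * t) 2 0 := by
      simpa using ((hasDerivAt_id (0 : ℝ)).const_mul 2).const_add (2 * z)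
    simp_rw [hq]
    rw [iteratedDeriv_succ, iteratedDeriv_one, h1, (h2.fun_div (hqd 0) (hqpos 0).ne').deriv]
    simp
    field_simp
    ring
  have hn : ‖x - x₀‖ ^ 2 = (x - x₀) 0 ^ 2 + (x - x₀) 1 ^ 2 := by
    rw [EuclideanSpace.norm_sq_eq]; simp
  have hs2 : s ^ 2 = D - ((x - x₀) 0 ^ 2 + (x - x₀) 1 ^ 2) := by rw [hD, hn]; ring
  unfold lap
  rw [Finset.sum_congr rfl fun i _ => hline i, Fin.sum_univ_two, hs2]
  field_simp
  ring

/-- The total mass of the Laplacian of the regularized logarithmic potential. -/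
def peakMass : ℝ := ∫ x : R2, 4 / (‖x‖ ^ 2 + 1) ^ 2

lemma integrable_peak : Integrable fun x : R2 => 4 / (‖x‖ ^ 2 + 1) ^ 2 := by
  have h := (integrable_rpow_neg_one_add_norm_sq (E := R2) (μ := volume) (r := 4)
    (by simp; norm_num)).const_mul 4
  refine h.congr (Eventually.of_forall fun x => ?_)
  have : (-4 / 2 : ℝ) = -((2 : ℕ) : ℝ) := by norm_num
  simp only [this]
  rw [Real.rpow_neg (by positivity), Real.rpow_natCast, div_eq_mul_inv, add_comm]

lemma peakMass_pos : 0 < peakMass := by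
  refine integral_pos_of_integrable_nonneg_nonzero (x := 0) ?_ integrable_peak ?_ ?_
  · exact continuous_const.div (by fun_prop) fun x => by positivity
  · intro x; positivity
  · simp

lemma tendsto_integral_mul_peak {g : R2 → ℝ} (hg : Integrable g) (hc : Continuous g) (x₀ : R2) :
    Tendsto (fun c : ℝ => ∫ x, g x * (4 * c⁻¹ ^ 2 / (‖x - x₀‖ ^ 2 + c⁻¹ ^ 2) ^ 2)) atTop
      (nhds (peakMass * g x₀)) := by
  have hdim : Module.finrank ℝ R2 = 2 := by simp
  have h := tendsto_integral_comp_smul_smul_of_integrable' (μ := (volume : Measure R2))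
    (φ := fun x : R2 => peakMass⁻¹ * (4 / (‖x‖ ^ 2 + 1) ^ 2)) (g := g) (x₀ := x₀)
    (fun x => mul_nonneg (inv_nonneg.2 peakMass_pos.le) (by positivity))
    (by rw [integral_const_mul]; exact inv_mul_cancel₀ peakMass_pos.ne')
    ?_ hg hc.continuousAt
  · have h' := h.const_mul peakMass
    refine h'.congr' ?_
    filter_upwards [eventually_gt_atTop 0] with c hcpos
    rw [← integral_const_mul]
    refine integral_congr_ae (Eventually.of_forall fun x => ?_)
    simp only [hdim, norm_smul, smul_eq_mul, norm_sub_rev x₀ x, Real.norm_eq_abs, mul_pow, sq_abs]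
    have := peakMass_pos
    field_simp
  · rw [hdim]
    have h0 : Tendsto (fun x : R2 => peakMass⁻¹ * 4 * (‖x‖ ^ 2)⁻¹) (Bornology.cobounded R2)
        (nhds 0) := by
      have h1 : Tendsto (fun x : R2 => ‖x‖ ^ 2) (Bornology.cobounded R2) atTop :=
        (tendsto_pow_atTop (by norm_num)).comp tendsto_norm_cobounded_atTop
      simpa using h1.inv_tendsto_atTop.const_mul (peakMass⁻¹ * 4)
    have hp := peakMass_pos
    refine squeeze_zero' (Eventually.of_forall fun x => by positivity) ?_ h0
    filter_upwards [(tendsto_norm_cobounded_atTop (E := R2)).eventually_gt_atTop 0] with x hx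
    have e1 : ‖x‖ ^ 2 * (peakMass⁻¹ * (4 / (‖x‖ ^ 2 + 1) ^ 2)) =
        peakMass⁻¹ * 4 * (‖x‖ ^ 2 / (‖x‖ ^ 2 + 1) ^ 2) := by ring
    rw [e1]
    refine mul_le_mul_of_nonneg_left ?_ (by positivity)
    rw [inv_eq_one_div, div_le_div_iff₀ (by positivity) (by positivity)]
    nlinarith [sq_nonneg ‖x‖]

/-- The function `‖x‖⁻¹` on the open unit disc, extended by zero. -/
def discInv (x : R2) : ℝ := if ‖x‖ < 1 then ‖x‖⁻¹ else 0

lemma discInv_nonneg (x : R2) : 0 ≤ discInv x := by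
  unfold discInv; split_ifs <;> positivity

lemma integrable_discInv : Integrable discInv := by
  have h := integrable_fun_norm_addHaar (E := R2) (volume : Measure R2)
    (f := fun r : ℝ => if r < 1 then r⁻¹ else 0)
  refine h.2 ?_
  have hdim : Module.finrank ℝ R2 = 2 := by simp
  have h1 : IntegrableOn ((Ioo (0 : ℝ) 1).indicator fun _ => (1 : ℝ)) (Ioi 0) :=
    ((integrable_indicator_iff measurableSet_Ioo).2 (by simp)).integrableOn
  refine h1.congr_fun (fun y hy => ?_) measurableSet_Ioi
  have hy' : 0 < y := hy
  by_cases h : y < 1 <;> simp [hdim, h, hy', hy'.ne']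

lemma integrable_discInv_comp {R : ℝ} (hR : 0 < R) (x₀ : R2) :
    Integrable fun x => discInv (R⁻¹ • (x - x₀)) :=
  (integrable_discInv.comp_smul (inv_ne_zero hR.ne')).comp_sub_right x₀

lemma integral_discInv_comp (R : ℝ) (x₀ : R2) :
    ∫ x, discInv (R⁻¹ • (x - x₀)) = R ^ 2 * ∫ x, discInv x := by
  rw [integral_sub_right_eq_self (fun x => discInv (R⁻¹ • x)) x₀, Measure.integral_comp_smul]
  simp

lemma exp_half_log_sub_log_le {R ε : ℝ} (hR : 0 < R) (hε : 0 < ε) {x x₀ : R2} (hx : x ≠ x₀) :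
    Real.exp ((Real.log (‖x - x₀‖ ^ 2 + R ^ 2) - Real.log (‖x - x₀‖ ^ 2 + ε ^ 2)) / 2) ≤
      2 + discInv (R⁻¹ • (x - x₀)) := by
  set r := ‖x - x₀‖ with hr
  have hrpos : 0 < r := norm_pos_iff.2 (sub_ne_zero.2 hx)
  have hstep : R / r ≤ 1 + discInv (R⁻¹ • (x - x₀)) := by
    unfold discInv
    rw [norm_smul, ← hr, norm_inv, Real.norm_of_nonneg hR.le]
    split_ifs with h
    · rw [mul_inv, inv_inv, div_eq_mul_inv]; linarith
    · rw [add_zero, div_le_one hrpos]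
      rw [not_lt, inv_mul_eq_div, one_le_div hR] at h
      exact h
  have h1 : Real.log (r ^ 2 + R ^ 2) - Real.log (r ^ 2 + ε ^ 2) ≤ 2 * Real.log (1 + R / r) := by
    have : 2 * Real.log (1 + R / r) = Real.log ((1 + R / r) ^ 2) := by simp [Real.log_pow]
    rw [this, ← Real.log_div (by positivity) (by positivity)]
    refine Real.log_le_log (by positivity) ?_
    calc (r ^ 2 + R ^ 2) / (r ^ 2 + ε ^ 2) ≤ (r ^ 2 + R ^ 2) / r ^ 2 := by
          gcongr; nlinarith [sq_nonneg ε]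
      _ = 1 + (R / r) ^ 2 := by field_simp
      _ ≤ (1 + R / r) ^ 2 := by nlinarith [div_pos hR hrpos]
  calc Real.exp ((Real.log (r ^ 2 + R ^ 2) - Real.log (r ^ 2 + ε ^ 2)) / 2)
      ≤ Real.exp (Real.log (1 + R / r)) := Real.exp_le_exp.2 (by linarith)
    _ = 1 + R / r := Real.exp_log (by positivity)
    _ ≤ _ := by linarith

/-- Young's inequality for the pair `exp` and `b log b`. -/
lemma mul_le_exp_add_mul_log (a : ℝ) {b : ℝ} (hb : 0 < b) :
    a * b ≤ Real.exp a + b * Real.log b := by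
  have h : Real.exp a = b * Real.exp (a - Real.log b) := by
    rw [Real.exp_sub, Real.exp_log hb]; field_simp
  rw [h]
  nlinarith [Real.add_one_le_exp (a - Real.log b)]

lemma integrableOn_comp_of_continuousOn_closure {Ω : Set R2} (hb : Bornology.IsBounded Ω)
    {u : R2 → ℝ} (hu : ContinuousOn u (closure Ω)) {F : ℝ → ℝ} (hF : Continuous F) :
    IntegrableOn (fun x => F (u x)) Ω :=
  ((hF.comp_continuousOn hu).integrableOn_compact hb.isCompact_closure).mono_set subset_closure

/-- Weak minimum principle for strictly superharmonic functions. -/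
lemma nonneg_of_lap_neg {Ω : Set R2} (ho : IsOpen Ω) (hb : Bornology.IsBounded Ω)
    {u : R2 → ℝ} (hu : ContinuousOn u (closure Ω)) (h0 : ∀ p ∈ frontier Ω, u p = 0)
    (hlap : ∀ p ∈ Ω, lap u p < 0) {p : R2} (hp : p ∈ Ω) : 0 ≤ u p := by
  obtain ⟨q, hq, hmin⟩ := hb.isCompact_closure.exists_isMinOn ⟨p, subset_closure hp⟩ hu
  by_cases hqΩ : q ∈ Ω
  · have hn : Ω ∈ nhds q := ho.mem_nhds hqΩ
    have hcl : closure Ω ∈ nhds q := mem_of_superset hn subset_closure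
    have := lap_nonneg_of_isLocalMin (hu.continuousAt hcl) (hmin.isLocalMin hcl)
    exact absurd (hlap q hqΩ) (not_lt.2 this)
  · have : q ∈ frontier Ω := ⟨hq, by rwa [ho.interior_eq]⟩
    rw [← h0 q this]
    exact hmin (subset_closure hp)

/-- The truncation of `u`, extended by zero outside `Ω`. -/
def truncExt (Ω : Set R2) (u : R2 → ℝ) : R2 → ℝ := Ω.indicator fun x => truncation (u x)

lemma truncExt_eventuallyEq {Ω : Set R2} (ho : IsOpen Ω) (u : R2 → ℝ) {p : R2} (hp : p ∈ Ω) :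
    truncExt Ω u =ᶠ[nhds p] fun x => truncation (u x) := by
  filter_upwards [ho.mem_nhds hp] with x hx
  exact indicator_of_mem hx _

lemma truncExt_eventuallyEq_zero {Ω : Set R2} {u : R2 → ℝ}
    (hu : ContinuousOn u (closure Ω)) (h0 : ∀ p ∈ frontier Ω, u p = 0) {p : R2} (hp : p ∉ Ω) :
    truncExt Ω u =ᶠ[nhds p] 0 := by
  by_cases hcl : p ∈ closure Ω
  · have hfr : p ∈ frontier Ω := ⟨hcl, fun h => hp (interior_subset h)⟩
    have hlt : u p < 1 := by rw [h0 p hfr]; exact one_pos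
    have hev := (hu p hcl).eventually (gt_mem_nhds hlt)
    filter_upwards [eventually_nhdsWithin_iff.1 hev] with x hx
    by_cases hxΩ : x ∈ Ω
    · simp [truncExt, hxΩ, truncation_of_le_one (hx (subset_closure hxΩ)).le]
    · simp [truncExt, hxΩ]
  · filter_upwards [isClosed_closure.isOpen_compl.mem_nhds hcl] with x hx
    have hxΩ : x ∉ Ω := fun h => hx (subset_closure h)
    simp [truncExt, hxΩ]

lemma contDiff_truncExt {Ω : Set R2} (ho : IsOpen Ω) {u : R2 → ℝ} (hd : ContDiffOn ℝ 2 u Ω)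
    (hu : ContinuousOn u (closure Ω)) (h0 : ∀ p ∈ frontier Ω, u p = 0) :
    ContDiff ℝ 2 (truncExt Ω u) := by
  refine contDiff_iff_contDiffAt.2 fun p => ?_
  by_cases hp : p ∈ Ω
  · exact (contDiff_truncation.contDiffAt.comp p
      (hd.contDiffAt (ho.mem_nhds hp))).congr_of_eventuallyEq (truncExt_eventuallyEq ho u hp)
  · exact contDiffAt_const.congr_of_eventuallyEq (truncExt_eventuallyEq_zero hu h0 hp)

lemma hasCompactSupport_truncExt {Ω : Set R2} (hb : Bornology.IsBounded Ω) (u : R2 → ℝ) :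
    HasCompactSupport (truncExt Ω u) :=
  HasCompactSupport.of_support_subset_isCompact hb.isCompact_closure
    (support_indicator_subset.trans subset_closure)

lemma neg_lap_truncExt_le {Ω : Set R2} (ho : IsOpen Ω) {u : R2 → ℝ} (hd : ContDiffOn ℝ 2 u Ω)
    (hu : ContinuousOn u (closure Ω)) (h0 : ∀ p ∈ frontier Ω, u p = 0)
    {f : R2 → ℝ} (hf : ∀ p ∈ Ω, -lap u p = f p) (hf0 : ∀ p ∈ Ω, 0 ≤ f p) (p : R2) :
    -lap (truncExt Ω u) p ≤ Ω.indicator f p := by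
  by_cases hp : p ∈ Ω
  · rw [indicator_of_mem hp, lap_congr (truncExt_eventuallyEq ho u hp)]
    have h := deriv_mul_lap_le_lap_comp contDiff_truncation deriv_deriv_truncation_nonneg
      (hd.contDiffAt (ho.mem_nhds hp))
    rw [deriv_truncation] at h
    have h1 := Real.smoothTransition.le_one (u p - 1)
    have h2 := hf p hp
    nlinarith [hf0 p hp]
  · rw [indicator_of_notMem hp, lap_congr (truncExt_eventuallyEq_zero hu h0 hp)]
    simp [lap]

/-- Green's representation at two scales `ε < R`, as an inequality for the truncation. -/
lemma integral_truncExt_mul_peak_le {Ω : Set R2} (ho : IsOpen Ω) (hb : Bornology.IsBounded Ω)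
    {u : R2 → ℝ} (hd : ContDiffOn ℝ 2 u Ω) (hu : ContinuousOn u (closure Ω))
    (h0 : ∀ p ∈ frontier Ω, u p = 0) (hpos : ∀ p ∈ Ω, 0 ≤ u p)
    {F : ℝ → ℝ} (hFc : Continuous F) (hf : ∀ p ∈ Ω, -lap u p = F (u p))
    (hF0 : ∀ s, 0 ≤ F s) {R ε : ℝ} (hε : 0 < ε) (hεR : ε ≤ R) (x₀ : R2) :
    ∫ x, truncExt Ω u x * (4 * ε ^ 2 / (‖x - x₀‖ ^ 2 + ε ^ 2) ^ 2) ≤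
      4 / R ^ 2 * (∫ x in Ω, u x) + ∫ x in Ω, F (u x) *
        (Real.log (‖x - x₀‖ ^ 2 + R ^ 2) - Real.log (‖x - x₀‖ ^ 2 + ε ^ 2)) := by
  have hR : 0 < R := hε.trans_le hεR
  set w := truncExt Ω u with hw
  have hwc : ContDiff ℝ 2 w := contDiff_truncExt ho hd hu h0
  have hws : HasCompactSupport w := hasCompactSupport_truncExt hb u
  have hls := hasCompactSupport_lap hws
  have hlc := continuous_lap hwc
  have cR := (contDiff_log_normSq_add hR x₀).continuous
  have cε := (contDiff_log_normSq_add hε x₀).continuous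
  have gR := integral_mul_lap hwc hws (contDiff_log_normSq_add hR x₀)
  have gε := integral_mul_lap hwc hws (contDiff_log_normSq_add hε x₀)
  simp_rw [lap_log_normSq_add hR x₀] at gR
  simp_rw [lap_log_normSq_add hε x₀] at gε
  have iR : Integrable fun x => lap w x * Real.log (‖x - x₀‖ ^ 2 + R ^ 2) :=
    (hlc.mul cR).integrable_of_hasCompactSupport (μ := volume) hls.mul_right
  have iε : Integrable fun x => lap w x * Real.log (‖x - x₀‖ ^ 2 + ε ^ 2) :=
    (hlc.mul cε).integrable_of_hasCompactSupport (μ := volume) hls.mul_right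
  have hsplit : ∫ x, w x * (4 * ε ^ 2 / (‖x - x₀‖ ^ 2 + ε ^ 2) ^ 2) =
      (∫ x, w x * (4 * R ^ 2 / (‖x - x₀‖ ^ 2 + R ^ 2) ^ 2)) + ∫ x, -lap w x *
        (Real.log (‖x - x₀‖ ^ 2 + R ^ 2) - Real.log (‖x - x₀‖ ^ 2 + ε ^ 2)) := by
    have : ∀ x, -lap w x *
        (Real.log (‖x - x₀‖ ^ 2 + R ^ 2) - Real.log (‖x - x₀‖ ^ 2 + ε ^ 2)) =
        lap w x * Real.log (‖x - x₀‖ ^ 2 + ε ^ 2) -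
          lap w x * Real.log (‖x - x₀‖ ^ 2 + R ^ 2) := fun x => by ring
    simp_rw [this]
    rw [integral_sub iε iR, gε, gR]
    ring
  rw [hsplit]
  have hlog : ∀ x : R2,
      0 ≤ Real.log (‖x - x₀‖ ^ 2 + R ^ 2) - Real.log (‖x - x₀‖ ^ 2 + ε ^ 2) := fun x =>
    sub_nonneg.2 (Real.log_le_log (by positivity) (by gcongr))
  refine add_le_add ?_ ?_
  · rw [← integral_const_mul, ← integral_indicator ho.measurableSet]
    refine integral_mono ?_ ?_ fun x => ?_
    · refine (hwc.continuous.mul ?_).integrable_of_hasCompactSupport hws.mul_right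
      exact continuous_const.div (by fun_prop) fun x => by positivity
    · exact (integrable_indicator_iff ho.measurableSet).2
        ((integrableOn_comp_of_continuousOn_closure hb hu continuous_id).const_mul _)
    · by_cases hx : x ∈ Ω
      · simp only [hw, truncExt, indicator_of_mem hx]
        rw [mul_comm]
        refine mul_le_mul ?_ (truncation_le_self (hpos x hx)) (truncation_nonneg _) (by positivity)
        rw [div_le_div_iff₀ (by positivity) (by positivity)]
        nlinarith [sq_nonneg (‖x - x₀‖ ^ 2), mul_nonneg (sq_nonneg ‖x - x₀‖) (sq_nonneg R)]
      · simp [hw, truncExt, hx]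
  · rw [← integral_indicator ho.measurableSet]
    refine integral_mono ?_ ?_ fun x => ?_
    · exact (hlc.neg.mul (cR.sub cε)).integrable_of_hasCompactSupport hls.neg.mul_right
    · refine (integrable_indicator_iff ho.measurableSet).2 ?_
      exact (((hFc.comp_continuousOn hu).mul (cR.sub cε).continuousOn).integrableOn_compact
        hb.isCompact_closure).mono_set subset_closure
    · have h := neg_lap_truncExt_le ho hd hu h0 hf (fun p _ => hF0 (u p)) x
      have := mul_le_mul_of_nonneg_right h (hlog x)
      by_cases hx : x ∈ Ω
      · simpa [hx] using this
      · simpa [hx] using this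

lemma le_exp_mul_sub_add {K s : ℝ} (hK : 0 ≤ K) (hs : 0 ≤ s) :
    s ≤ Real.exp s * (s - K) + ((K + 1) + K * Real.exp (K + 1)) := by
  have hE := Real.add_one_le_exp s
  have hE' := Real.exp_pos (K + 1)
  rcases le_total (K + 1) s with h | h
  · nlinarith [mul_nonneg hK hE'.le, Real.exp_pos s]
  · have := Real.exp_le_exp.2 h
    nlinarith [mul_nonneg (Real.exp_pos s).le hs, mul_le_mul_of_nonneg_left this hK]

/-- A bound on the mean of `u` under the Gibbs density bounds the plain mean of `u`. -/
lemma integral_le_of_gibbs_mean_le {Ω : Set R2} (hb : Bornology.IsBounded Ω)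
    (ho : IsOpen Ω) {u : R2 → ℝ} (hu : ContinuousOn u (closure Ω))
    (hpos : ∀ p ∈ Ω, 0 ≤ u p) {K : ℝ} (hK : 0 ≤ K)
    (hmean : ∫ x in Ω, Real.exp (u x) * u x ≤ K * ∫ x in Ω, Real.exp (u x)) :
    ∫ x in Ω, u x ≤ ((K + 1) + K * Real.exp (K + 1)) * volume.real Ω := by
  have i1 := integrableOn_comp_of_continuousOn_closure hb hu continuous_id
  have i2 := integrableOn_comp_of_continuousOn_closure hb hu Real.continuous_exp
  have i3 : IntegrableOn (fun x => Real.exp (u x) * u x) Ω :=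
    integrableOn_comp_of_continuousOn_closure hb hu (F := fun s => Real.exp s * s) (by fun_prop)
  have hfin : volume Ω ≠ ⊤ := hb.measure_lt_top.ne
  have i4 : IntegrableOn (fun x => Real.exp (u x) * u x - K * Real.exp (u x)) Ω :=
    i3.sub (i2.const_mul K)
  set C := (K + 1) + K * Real.exp (K + 1) with hC
  have hle : ∫ x in Ω, u x ≤ ∫ x in Ω, ((Real.exp (u x) * u x - K * Real.exp (u x)) + C) := by
    refine setIntegral_mono_on i1 (i4.add (integrableOn_const hfin))
      ho.measurableSet fun x hx => ?_
    have := le_exp_mul_sub_add hK (hpos x hx)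
    linarith
  have hcalc : ∫ x in Ω, ((Real.exp (u x) * u x - K * Real.exp (u x)) + C) =
      (∫ x in Ω, Real.exp (u x) * u x) - K * (∫ x in Ω, Real.exp (u x)) + C * volume.real Ω := by
    rw [integral_add i4 (integrableOn_const hfin).integrable, integral_sub i3 (i2.const_mul K),
      integral_const_mul, setIntegral_const, smul_eq_mul, mul_comm C]
  linarith

/-- The logarithmic potential of the Gibbs density is bounded in terms of its entropy. -/
lemma integral_gibbs_mul_log_le {Ω : Set R2} (ho : IsOpen Ω) (hb : Bornology.IsBounded Ω)
    {u : R2 → ℝ} (hu : ContinuousOn u (closure Ω))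
    {I K : ℝ} (hI : volume.real Ω ≤ I)
    (hmean : ∫ x in Ω, Real.exp (u x) / I * u x ≤ K)
    {R ε : ℝ} (hε : 0 < ε) (hR : 0 < R) (hvol : R ^ 2 = volume.real Ω) (x₀ : R2) :
    ∫ x in Ω, Real.exp (u x) / I *
        (Real.log (‖x - x₀‖ ^ 2 + R ^ 2) - Real.log (‖x - x₀‖ ^ 2 + ε ^ 2)) ≤
      2 * (2 + (∫ x, discInv x) + K) := by
  have hV : 0 < volume.real Ω := hvol ▸ by positivity
  have hIpos : 0 < I := hV.trans_le hI
  have hfin : volume Ω ≠ ⊤ := hb.measure_lt_top.ne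
  have cR := (contDiff_log_normSq_add hR x₀).continuous
  have cε := (contDiff_log_normSq_add hε x₀).continuous
  have i1 : IntegrableOn (fun x => Real.exp (u x) / I * u x) Ω :=
    integrableOn_comp_of_continuousOn_closure hb hu
      (F := fun s => Real.exp s / I * s) (by fun_prop)
  have ik := integrable_discInv_comp hR x₀
  have i2 : IntegrableOn (fun x => 2 + discInv (R⁻¹ • (x - x₀))) Ω :=
    (integrableOn_const hfin).add ik.integrableOn
  have hne : ∀ᵐ x ∂(volume.restrict Ω), x ≠ x₀ :=
    ae_restrict_of_ae (by simp [ae_iff])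
  have hle : ∫ x in Ω, Real.exp (u x) / I *
      (Real.log (‖x - x₀‖ ^ 2 + R ^ 2) - Real.log (‖x - x₀‖ ^ 2 + ε ^ 2)) ≤
      ∫ x in Ω, (2 * (R ^ 2)⁻¹ * (2 + discInv (R⁻¹ • (x - x₀))) +
        2 * (Real.exp (u x) / I * u x)) := by
    refine integral_mono_ae ?_ ((i2.const_mul _).add (i1.const_mul 2)) ?_
    · exact ((((Real.continuous_exp.comp_continuousOn hu).div_const I).mul
        (cR.sub cε).continuousOn).integrableOn_compact hb.isCompact_closure).mono_set subset_closure
    · filter_upwards [hne, ae_restrict_mem ho.measurableSet] with x hx hxΩ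
      have h1 := exp_half_log_sub_log_le hR hε hx
      set A := Real.log (‖x - x₀‖ ^ 2 + R ^ 2) - Real.log (‖x - x₀‖ ^ 2 + ε ^ 2)
      set d := Real.exp (u x) / I with hd
      have hdpos : 0 < d := by positivity
      have hy := mul_le_exp_add_mul_log (A / 2) (b := R ^ 2 * d) (by positivity)
      have hlog : Real.log (R ^ 2 * d) ≤ u x := by
        rw [Real.log_le_iff_le_exp (by positivity), hd, hvol, mul_div_assoc', div_le_iff₀ hIpos,
          mul_comm]
        exact mul_le_mul_of_nonneg_left hI (Real.exp_pos _).le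
      have hb2 := mul_le_mul_of_nonneg_left hlog (by positivity : 0 ≤ R ^ 2 * d)
      have hfinal : R ^ 2 * (d * A) ≤
          2 * (2 + discInv (R⁻¹ • (x - x₀))) + R ^ 2 * (2 * (d * u x)) := by nlinarith
      have hR2 : 0 < R ^ 2 := by positivity
      have hrw : 2 * (R ^ 2)⁻¹ * (2 + discInv (R⁻¹ • (x - x₀))) + 2 * (d * u x) =
          (2 * (2 + discInv (R⁻¹ • (x - x₀))) + R ^ 2 * (2 * (d * u x))) / R ^ 2 := by
        field_simp
      rw [hrw, le_div_iff₀ hR2, mul_comm]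
      exact hfinal
  refine hle.trans ?_
  rw [integral_add (i2.const_mul _) (i1.const_mul 2), integral_const_mul, integral_const_mul,
    integral_add (integrableOn_const hfin).integrable ik.integrableOn, setIntegral_const, smul_eq_mul,
    ← hvol]
  have hdisc : ∫ x in Ω, discInv (R⁻¹ • (x - x₀)) ≤ R ^ 2 * ∫ x, discInv x := by
    rw [← integral_discInv_comp R x₀]
    exact setIntegral_le_integral ik (Eventually.of_forall fun x => discInv_nonneg _)
  have h3 : 2 * (R ^ 2)⁻¹ * (R ^ 2 * 2 + ∫ x in Ω, discInv (R⁻¹ • (x - x₀))) ≤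
      2 * (R ^ 2)⁻¹ * (R ^ 2 * 2 + R ^ 2 * ∫ x, discInv x) := by gcongr
  have h4 : 2 * (R ^ 2)⁻¹ * (R ^ 2 * 2 + R ^ 2 * ∫ x, discInv x) = 2 * (2 + ∫ x, discInv x) := by
    field_simp
  linarith

/-- Uniform a priori bound: for `λ̄ ≥ 8π`, `Ē ≥ 1` there is `C̄ > 0` (independent of the
solution and of the domain) bounding every solution of `P(λ,Ω)` with `λ ≤ λ̄` and energy
`ℰ(u) ≤ Ē` on any simple domain; moreover `u ≥ 0`. -/
theorem statement4 (lamBar EBar : ℝ) (hl : 8 * π ≤ lamBar) (hE : 1 ≤ EBar) :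
    ∃ Cbar : ℝ, 0 < Cbar ∧
      ∀ Ω : Set R2, IsSimpleDomain Ω → ∀ lam ∈ Set.Ioc (0 : ℝ) lamBar,
        ∀ u : R2 → ℝ, IsSolP Ω lam u → energyE Ω lam u ≤ EBar →
          ∀ p ∈ Ω, 0 ≤ u p ∧ u p ≤ Cbar := by
  set K := 2 * lamBar * EBar with hKdef
  have hlb : 0 < lamBar := lt_of_lt_of_le (by positivity) hl
  have hK : 0 ≤ K := by positivity
  set c₁ := ∫ x, discInv x with hc₁
  have hc₁0 : 0 ≤ c₁ := integral_nonneg discInv_nonneg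
  set M := 4 * ((K + 1) + K * Real.exp (K + 1)) + lamBar * (2 * (2 + c₁ + K)) with hM
  have hM0 : 0 ≤ M := by positivity
  have hm := peakMass_pos
  refine ⟨M / peakMass + 2, by positivity, ?_⟩
  rintro Ω ⟨ho, hb, -, -⟩ lam ⟨hlam, hlamle⟩ u ⟨hd, hu, h0, heq⟩ hen p hp
  have hfin : volume Ω ≠ ⊤ := hb.measure_lt_top.ne
  have hV : 0 < volume.real Ω :=
    ENNReal.toReal_pos (ho.measure_pos volume ⟨p, hp⟩).ne' hfin
  have iexp := integrableOn_comp_of_continuousOn_closure hb hu Real.continuous_exp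
  set I := ∫ q in Ω, Real.exp (u q) with hI
  have hIpos : 0 < I := by
    rw [hI, setIntegral_pos_iff_support_of_nonneg_ae
      (Eventually.of_forall fun x => (Real.exp_pos _).le) iexp]
    have : Function.support (fun q => Real.exp (u q)) = univ :=
      eq_univ_of_forall fun x => (Real.exp_pos _).ne'
    rw [this, univ_inter]
    exact ho.measure_pos volume ⟨p, hp⟩
  have hpos : ∀ q ∈ Ω, 0 ≤ u q := fun q hq =>
    nonneg_of_lap_neg ho hb hu h0 (fun x hx => by
      have h1 := heq x hx
      have h2 : 0 < lam * Real.exp (u x) / I := by positivity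
      linarith) hq
  refine ⟨hpos p hp, ?_⟩
  have hVI : volume.real Ω ≤ I := by
    have h1 : ∫ q in Ω, (1 : ℝ) ≤ I := by
      refine setIntegral_mono_on (integrableOn_const hfin) iexp ho.measurableSet fun x hx => ?_
      exact Real.one_le_exp (hpos x hx)
    simpa using h1
  have hmean : ∫ x in Ω, Real.exp (u x) / I * u x ≤ K := by
    unfold energyE at hen
    rw [one_div, inv_mul_le_iff₀ (by positivity)] at hen
    refine hen.trans ?_
    rw [hKdef]
    gcongr
  have hmean' : ∫ x in Ω, Real.exp (u x) * u x ≤ K * I := by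
    have : ∀ x, Real.exp (u x) / I * u x = (Real.exp (u x) * u x) / I := fun x => by ring
    simp_rw [this] at hmean
    rwa [integral_div, div_le_iff₀ hIpos] at hmean
  have hint := integral_le_of_gibbs_mean_le hb ho hu hpos hK hmean'
  set R := √(volume.real Ω) with hRdef
  have hR : 0 < R := Real.sqrt_pos.2 hV
  have hvol : R ^ 2 = volume.real Ω := Real.sq_sqrt hV.le
  have hbound : ∀ ε, 0 < ε → ε ≤ R →
      ∫ x, truncExt Ω u x * (4 * ε ^ 2 / (‖x - p‖ ^ 2 + ε ^ 2) ^ 2) ≤ M := by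
    intro ε hε hεR
    have h1 := integral_truncExt_mul_peak_le ho hb hd hu h0 hpos
      (F := fun s => lam * (Real.exp s / I)) (by fun_prop)
      (fun x hx => by rw [heq x hx, mul_div_assoc]) (fun s => by positivity) hε hεR p
    simp_rw [mul_assoc lam] at h1
    rw [integral_const_mul] at h1
    have h2 := integral_gibbs_mul_log_le ho hb hu hVI hmean hε hR hvol p
    have h3 : 4 / R ^ 2 * ∫ x in Ω, u x ≤ 4 * ((K + 1) + K * Real.exp (K + 1)) := by
      rw [hvol, div_mul_eq_mul_div, div_le_iff₀ hV]
      linarith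
    have h4 : lam * (∫ x in Ω, Real.exp (u x) / I *
        (Real.log (‖x - p‖ ^ 2 + R ^ 2) - Real.log (‖x - p‖ ^ 2 + ε ^ 2))) ≤
        lamBar * (2 * (2 + c₁ + K)) :=
      (mul_le_mul_of_nonneg_left h2 hlam.le).trans
        (mul_le_mul_of_nonneg_right hlamle (by positivity))
    linarith
  have hwc := (contDiff_truncExt ho hd hu h0).continuous
  have hlim := tendsto_integral_mul_peak
    (hwc.integrable_of_hasCompactSupport (hasCompactSupport_truncExt hb u)) hwc p
  have hle : peakMass * truncExt Ω u p ≤ M := by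
    refine le_of_tendsto hlim ?_
    filter_upwards [eventually_ge_atTop R⁻¹] with c hc
    have hcpos : 0 < c := (inv_pos.2 hR).trans_le hc
    exact hbound c⁻¹ (inv_pos.2 hcpos) (inv_le_of_inv_le₀ hR hc)
  have hval : truncExt Ω u p = truncation (u p) := indicator_of_mem hp _
  rw [hval, ← le_div_iff₀' hm] at hle
  linarith [sub_two_le_truncation (u p)]
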